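/- With T* as in the local existence construction and S the set of bounded continuous functions v on ℝ × (0,T*] with ‖v‖_∞ ≤ ‖u₀‖_∞ + 1, the Duhamel map M defined by M[v](x,t) = ∫_ℝ u₀(s)G(x,t;s,0)ds + ∫₀^t ∫_ℝ (v²(s,τ)/2)(G(x,t;s,τ)h_α'(s) + G_s(x,t;s,τ)h_α(s))ds dτ satisfies ‖M[v₁] − M[v₂]‖_∞ ≤ (1/2)‖v₁ − v₂‖_∞ for all v₁, v₂ ∈ S. -/

import Mathlib

open MeasureTheory Real

noncomputable def G (x t s τ : ℝ) : ℝ :=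
  (1 / Real.sqrt (4 * Real.pi * (t - τ))) * Real.exp (-(x - s)^2 / (4 * (t - τ)))

noncomputable def hfun (α : ℝ) (x : ℝ) : ℝ := (1 + x^2) ^ (-α)

noncomputable def Mmap (α : ℝ) (u₀ : ℝ → ℝ) (v : ℝ → ℝ → ℝ) (x t : ℝ) : ℝ :=
  (∫ s : ℝ, u₀ s * G x t s 0) +
    ∫ τ in Set.Ioo 0 t, ∫ s : ℝ,
      (v s τ)^2 / 2 * (G x t s τ * deriv (hfun α) s +
        deriv (fun s' => G x t s' τ) s * hfun α s)

lemma aux_abs_gauss (b : ℝ) (hb : 0 < b) :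
    ∫ y : ℝ, |y| * Real.exp (-b * y ^ 2) = 1 / b := by
  have h := @integral_comp_abs (fun y => y * Real.exp (-b * y ^ 2))
  simp only [sq_abs] at h
  rw [h]
  have h2 := @integral_rpow_mul_exp_neg_mul_rpow 2 1 b (by norm_num) (by norm_num) hb
  norm_num [Real.rpow_neg_one] at h2
  simp only [neg_mul]
  rw [h2]
  field_simp

lemma aux_deriv_G (x t s τ : ℝ) :
    deriv (fun s' => G x t s' τ) s = G x t s τ * ((x - s) / (2 * (t - τ))) := by
  have h : HasDerivAt (fun s' => G x t s' τ)
      ((1 / Real.sqrt (4 * Real.pi * (t - τ))) * (Real.exp (-(x - s)^2 / (4 * (t - τ))) *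
        (-(2 * (x - s) * (-1)) / (4 * (t - τ))))) s := by
    unfold G
    refine HasDerivAt.const_mul _ (HasDerivAt.exp (HasDerivAt.div_const (HasDerivAt.fun_neg ?_) _))
    have := ((hasDerivAt_id s).const_sub x).fun_pow 2
    simpa using this
  rw [h.deriv]
  unfold G
  rw [show -(2 * (x - s) * (-1)) / (4 * (t - τ)) = (x - s) / (2 * (t - τ)) by
    rw [show -(2 * (x - s) * (-1)) = 2 * (x - s) by ring,
      show 4 * (t - τ) = 2 * (2 * (t - τ)) by ring, mul_div_mul_left _ _ two_ne_zero]]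
  ring

/-- Integrability and mass of the majorant kernel. -/
lemma aux_maj (H x t τ : ℝ) (h : τ < t) :
    Integrable (fun s => G x t s τ * (H + |x - s| / (2 * (t - τ)))) ∧
    ∫ s, G x t s τ * (H + |x - s| / (2 * (t - τ))) = H + (1 / √π) * (t - τ) ^ (-(1/2) : ℝ) := by
  have hc : 0 < t - τ := sub_pos.2 h
  set c := t - τ with hcdef
  have hb : 0 < 1 / (4 * c) := by positivity
  set b := 1 / (4 * c) with hbdef
  set a := 1 / √(4 * π * c) with hadef
  have e : (fun s => G x t s τ * (H + |x - s| / (2 * c))) = fun s =>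
      (fun y => a * H * Real.exp (-b * y ^ 2) + a / (2 * c) * (|y| * Real.exp (-b * y ^ 2))) (x - s) := by
    funext s
    simp only [G, ← hcdef, ← hadef]
    rw [show -(x - s) ^ 2 / (4 * c) = -b * (x - s) ^ 2 by rw [hbdef]; ring]
    ring
  have i1 : Integrable (fun y : ℝ => a * H * Real.exp (-b * y ^ 2)) :=
    (integrable_exp_neg_mul_sq hb).const_mul _
  have i2 : Integrable (fun y : ℝ => a / (2 * c) * (|y| * Real.exp (-b * y ^ 2))) := by
    refine Integrable.const_mul ?_ _
    have := (integrable_mul_exp_neg_mul_sq hb).norm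
    refine this.congr (Filter.Eventually.of_forall fun y => ?_)
    simp
  rw [e]
  refine ⟨(i1.add i2).comp_sub_left x, ?_⟩
  rw [integral_sub_left_eq_self (fun y => a * H * Real.exp (-b * y ^ 2) + a / (2 * c) * (|y| * Real.exp (-b * y ^ 2))) volume x,
    integral_add i1 i2, integral_const_mul, integral_const_mul, aux_abs_gauss b hb, integral_gaussian]
  have e1 : π / b = 4 * π * c := by rw [hbdef]; field_simp
  rw [e1, Real.rpow_neg hc.le, ← Real.sqrt_eq_rpow, hadef, hbdef]
  have e2 : √(4 * π * c) = 2 * √π * √c := by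
    rw [Real.sqrt_mul (by positivity), Real.sqrt_mul (by norm_num),
      show (4:ℝ) = 2 ^ 2 by norm_num, Real.sqrt_sq (by norm_num)]
  rw [e2]
  have : 0 < √π := by positivity
  have : 0 < √c := by positivity
  field_simp
  ring

lemma aux_outer (H t : ℝ) (ht : 0 < t) :
    IntegrableOn (fun τ => H + (1 / √π) * (t - τ) ^ (-(1/2) : ℝ)) (Set.Ioo 0 t) ∧
    ∫ τ in Set.Ioo 0 t, (H + (1 / √π) * (t - τ) ^ (-(1/2) : ℝ)) = H * t + 2 / √π * √t := by
  have ii : IntervalIntegrable (fun τ : ℝ => (t - τ) ^ (-(1/2) : ℝ)) volume 0 t := by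
    have := (intervalIntegral.intervalIntegrable_rpow' (a := t) (b := 0) (r := -(1/2)) (by norm_num)).comp_sub_left t
    simpa using this
  have i2 := ii.const_mul (1 / √π)
  have i1 : IntervalIntegrable (fun _ : ℝ => H) volume 0 t := intervalIntegrable_const
  refine ⟨(intervalIntegrable_iff_integrableOn_Ioo_of_le ht.le).1 (i1.add i2), ?_⟩
  rw [← integral_Ioc_eq_integral_Ioo, ← intervalIntegral.integral_of_le ht.le,
    intervalIntegral.integral_add i1 i2, intervalIntegral.integral_const_mul,
    intervalIntegral.integral_comp_sub_left (fun y => y ^ (-(1/2) : ℝ)) t,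
    integral_rpow (Or.inl (by norm_num)), Real.sqrt_eq_rpow t]
  norm_num
  ring

lemma aux_outer_meas (α : ℝ) (w : ℝ × ℝ → ℝ) (hw : Measurable w) (x t : ℝ) :
    StronglyMeasurable (fun τ => ∫ s : ℝ, w (s, τ) * (G x t s τ * deriv (hfun α) s +
        deriv (fun s' => G x t s' τ) s * hfun α s)) := by
  simp only [aux_deriv_G]
  have : Measurable (fun p : ℝ × ℝ => w (p.2, p.1) * (G x t p.2 p.1 * deriv (hfun α) p.2 +
        G x t p.2 p.1 * ((x - p.2) / (2 * (t - p.1))) * hfun α p.2)) := by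
    have hd : Measurable (fun p : ℝ × ℝ => deriv (hfun α) p.2) := (measurable_deriv _).comp measurable_snd
    have hg : Measurable (fun p : ℝ × ℝ => G x t p.2 p.1) := by unfold G; fun_prop
    have hh : Measurable (fun p : ℝ × ℝ => hfun α p.2) := by unfold hfun; fun_prop
    fun_prop
  exact this.stronglyMeasurable.integral_prod_right'

lemma aux_kernel (α : ℝ) (hα : 0 < α) (H : ℝ) (hH : ∀ x, |deriv (hfun α) x| ≤ H)
    (x t s τ : ℝ) (h : τ < t) :
    |G x t s τ * deriv (hfun α) s + deriv (fun s' => G x t s' τ) s * hfun α s| ≤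
      G x t s τ * (H + |x - s| / (2 * (t - τ))) := by
  have hc : 0 < t - τ := sub_pos.2 h
  have hG : 0 ≤ G x t s τ := by unfold G; positivity
  have h0 : 0 ≤ hfun α s := by unfold hfun; positivity
  have h1 : hfun α s ≤ 1 :=
    Real.rpow_le_one_of_one_le_of_nonpos (by nlinarith [sq_nonneg s]) (by linarith)
  rw [aux_deriv_G, mul_assoc, ← mul_add, abs_mul, abs_of_nonneg hG]
  refine mul_le_mul_of_nonneg_left ((abs_add_le _ _).trans (add_le_add (hH s) ?_)) hG
  rw [abs_mul, abs_div, abs_of_pos (show 0 < 2 * (t - τ) by positivity), abs_of_nonneg h0]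
  exact mul_le_of_le_one_right (by positivity) h1

lemma aux_inner (α : ℝ) (hα : 0 < α) (H : ℝ) (hH : ∀ x, |deriv (hfun α) x| ≤ H)
    (x t τ : ℝ) (h : τ < t) (w : ℝ → ℝ) (hw : Measurable w) (C : ℝ) (hC : ∀ s, |w s| ≤ C) :
    Integrable (fun s : ℝ => w s * (G x t s τ * deriv (hfun α) s +
        deriv (fun s' => G x t s' τ) s * hfun α s)) ∧
    ‖∫ s : ℝ, w s * (G x t s τ * deriv (hfun α) s +
        deriv (fun s' => G x t s' τ) s * hfun α s)‖ ≤
      C * (H + (1 / √π) * (t - τ) ^ (-(1/2) : ℝ)) := by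
  obtain ⟨mi, mv⟩ := aux_maj H x t τ h
  have hb : ∀ s, ‖w s * (G x t s τ * deriv (hfun α) s +
        deriv (fun s' => G x t s' τ) s * hfun α s)‖ ≤
        C * (G x t s τ * (H + |x - s| / (2 * (t - τ)))) := fun s => by
    rw [Real.norm_eq_abs, abs_mul]
    exact mul_le_mul (hC s) (aux_kernel α hα H hH x t s τ h) (abs_nonneg _)
      ((abs_nonneg _).trans (hC s))
  constructor
  · refine (mi.const_mul C).mono' ?_ (Filter.Eventually.of_forall hb)
    have hd : Measurable (deriv (hfun α)) := measurable_deriv _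
    have hg : Measurable (fun s => G x t s τ) := by unfold G; fun_prop
    have hh : Measurable (hfun α) := by unfold hfun; fun_prop
    simp only [aux_deriv_G]
    apply Measurable.aestronglyMeasurable
    fun_prop
  · rw [← mv, ← integral_const_mul]
    exact norm_integral_le_of_norm_le (mi.const_mul C) (Filter.Eventually.of_forall hb)

theorem duhamel_map_contraction
    (α : ℝ) (hα : 0 < α)
    (u₀ : ℝ → ℝ) (hmeas : Measurable u₀)
    (N : ℝ) (hN : IsLUB (Set.range fun x => |u₀ x|) N)
    (H : ℝ) (hH : IsLUB (Set.range fun x => |deriv (hfun α) x|) H)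
    (Tstar : ℝ)
    (hT : Tstar = min 1 (min
      ((((N + 1)^2 * (H / 2 + 1 / Real.sqrt Real.pi))^2)⁻¹)
      (((4 * (N + 1) * (H / 2 + 1 / Real.sqrt Real.pi))^2)⁻¹)))
    (v₁ v₂ : ℝ → ℝ → ℝ)
    (hv₁cont : ContinuousOn (fun p : ℝ × ℝ => v₁ p.1 p.2) {p : ℝ × ℝ | 0 < p.2 ∧ p.2 ≤ Tstar})
    (hv₂cont : ContinuousOn (fun p : ℝ × ℝ => v₂ p.1 p.2) {p : ℝ × ℝ | 0 < p.2 ∧ p.2 ≤ Tstar})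
    (hv₁bdd : ∀ s τ : ℝ, |v₁ s τ| ≤ N + 1)
    (hv₂bdd : ∀ s τ : ℝ, |v₂ s τ| ≤ N + 1)
    (D : ℝ) (hD : ∀ s τ : ℝ, 0 < τ → τ ≤ Tstar → |v₁ s τ - v₂ s τ| ≤ D) :
    ∀ x t : ℝ, 0 < t → t ≤ Tstar →
      |Mmap α u₀ v₁ x t - Mmap α u₀ v₂ x t| ≤ (1 / 2) * D := by

  intro x t ht htT
  have hH' : ∀ x, |deriv (hfun α) x| ≤ H := fun x => hH.1 ⟨x, rfl⟩
  have hH0 : 0 ≤ H := (abs_nonneg _).trans (hH' 0)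
  have hN0 : 0 ≤ N := (abs_nonneg _).trans (hN.1 ⟨0, rfl⟩)
  have hD0 : 0 ≤ D := (abs_nonneg _).trans (hD 0 t ht htT)
  set S : Set (ℝ × ℝ) := {p : ℝ × ℝ | 0 < p.2 ∧ p.2 ≤ Tstar} with hS
  have hSm : MeasurableSet S :=
    (measurableSet_lt measurable_const measurable_snd).inter
      (measurableSet_le measurable_snd measurable_const)
  classical
  have key : ∀ v : ℝ → ℝ → ℝ, ContinuousOn (fun p : ℝ × ℝ => v p.1 p.2) S →
      Measurable (S.piecewise (fun p : ℝ × ℝ => v p.1 p.2) (fun _ => 0)) := fun v hv =>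
    hv.measurable_piecewise continuousOn_const hSm
  have val : ∀ v : ℝ → ℝ → ℝ, ∀ τ ∈ Set.Ioo 0 t, ∀ s,
      S.piecewise (fun p : ℝ × ℝ => v p.1 p.2) (fun _ => 0) (s, τ) = v s τ := fun v τ hτ s =>
    Set.piecewise_eq_of_mem _ _ _ ⟨hτ.1, hτ.2.le.trans htT⟩
  have slice : ∀ v : ℝ → ℝ → ℝ, ContinuousOn (fun p : ℝ × ℝ => v p.1 p.2) S →
      ∀ τ ∈ Set.Ioo 0 t, Measurable (fun s => v s τ) := fun v hv τ hτ => by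
    have := (key v hv).comp (measurable_id.prodMk (measurable_const (a := τ)))
    convert this using 1
    funext s
    exact (val v τ hτ s).symm
  obtain ⟨oi, ov⟩ := aux_outer H t ht
  have hsq : ∀ v : ℝ → ℝ → ℝ, (∀ s τ, |v s τ| ≤ N + 1) → ∀ s τ, |v s τ ^ 2 / 2| ≤ (N+1)^2/2 := by
    intro v hv s τ
    rw [abs_of_nonneg (by positivity), ← sq_abs]
    have := hv s τ
    gcongr
  have outInt : ∀ v : ℝ → ℝ → ℝ, ContinuousOn (fun p : ℝ × ℝ => v p.1 p.2) S →
      (∀ s τ, |v s τ| ≤ N + 1) → IntegrableOn (fun τ => ∫ s : ℝ,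
      (v s τ)^2 / 2 * (G x t s τ * deriv (hfun α) s +
        deriv (fun s' => G x t s' τ) s * hfun α s)) (Set.Ioo 0 t) := by
    intro v hv hvb
    refine (oi.const_mul ((N+1)^2/2)).mono' ?_ ?_
    · refine (aux_outer_meas α _ (((key v hv).pow_const 2).div_const 2) x t).aestronglyMeasurable.congr ?_
      refine (ae_restrict_mem measurableSet_Ioo).mono fun τ hτ => ?_
      simp only [val v τ hτ]
    · refine (ae_restrict_mem measurableSet_Ioo).mono fun τ hτ => ?_
      exact (aux_inner α hα H hH' x t τ hτ.2 _ (((slice v hv τ hτ).pow_const 2).div_const 2) _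
        (fun s => hsq v hvb s τ)).2
  have main : |Mmap α u₀ v₁ x t - Mmap α u₀ v₂ x t| ≤
      (N + 1) * D * (H * t + 2 / √π * √t) := by
    unfold Mmap
    rw [add_sub_add_left_eq_sub, ← integral_sub (outInt v₁ hv₁cont hv₁bdd) (outInt v₂ hv₂cont hv₂bdd),
      ← ov, ← integral_const_mul, ← Real.norm_eq_abs]
    refine norm_integral_le_of_norm_le (oi.const_mul _) ?_
    refine (ae_restrict_mem measurableSet_Ioo).mono fun τ hτ => ?_
    have m1 := ((slice v₁ hv₁cont τ hτ).pow_const 2).div_const 2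
    have m2 := ((slice v₂ hv₂cont τ hτ).pow_const 2).div_const 2
    have i1 := (aux_inner α hα H hH' x t τ hτ.2 _ m1 _ (fun s => hsq v₁ hv₁bdd s τ)).1
    have i2 := (aux_inner α hα H hH' x t τ hτ.2 _ m2 _ (fun s => hsq v₂ hv₂bdd s τ)).1
    rw [← integral_sub i1 i2]
    simp only [← sub_mul]
    refine (aux_inner α hα H hH' x t τ hτ.2 _ (m1.sub m2) _ fun s => ?_).2
    have hd := hD s τ hτ.1 (hτ.2.le.trans htT)
    have ha : |v₁ s τ + v₂ s τ| ≤ 2 * (N + 1) :=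
      (abs_add_le _ _).trans (by linarith [hv₁bdd s τ, hv₂bdd s τ])
    change |v₁ s τ ^ 2 / 2 - v₂ s τ ^ 2 / 2| ≤ _
    rw [show v₁ s τ ^ 2 / 2 - v₂ s τ ^ 2 / 2 = (v₁ s τ + v₂ s τ) * (v₁ s τ - v₂ s τ) / 2 by ring,
      abs_div, abs_mul, abs_two]
    have := mul_le_mul ha hd (abs_nonneg _) (by positivity)
    linarith
  refine main.trans ?_
  have hsp : 0 < √π := by positivity
  set K := H / 2 + 1 / √π with hK
  have hKpos : 0 < K := by positivity
  have t1 : t ≤ 1 := htT.trans (hT ▸ min_le_left _ _)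
  have t2 : t ≤ ((4 * (N + 1) * K)^2)⁻¹ :=
    htT.trans (hT ▸ (min_le_right _ _).trans (min_le_right _ _))
  have hA : 0 < 4 * (N + 1) * K := by positivity
  have s2 : √t ≤ (4 * (N + 1) * K)⁻¹ := by
    rw [← inv_pow] at t2
    exact Real.sqrt_le_iff.2 ⟨by positivity, t2⟩
  have s3 : √t * (4 * (N + 1) * K) ≤ 1 := by
    rwa [← one_div, le_div_iff₀ hA] at s2
  have s4 : t ≤ √t := by
    have : √t ≤ 1 := Real.sqrt_le_one.2 t1
    nlinarith [Real.sq_sqrt ht.le, Real.sqrt_nonneg t]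
  have s5 : H * t + 2 / √π * √t ≤ 2 * K * √t := by
    have : 2 * K * √t = H * √t + 2 / √π * √t := by rw [hK]; ring
    rw [this]
    gcongr
  calc (N + 1) * D * (H * t + 2 / √π * √t) ≤ (N + 1) * D * (2 * K * √t) := by gcongr
    _ = 1 / 2 * D * (√t * (4 * (N + 1) * K)) := by ring
    _ ≤ 1 / 2 * D * 1 := by gcongr
    _ = 1 / 2 * D := by ring
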